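/- The set of stable positive integers is a computable (algorithmically decidable) set; moreover, the stabilization length K(n) and the stable complexity ‖n‖_st are computable functions of n. -/

import Mathlib

/-- `CanWrite n k` means the positive integer `n` can be written using exactly `k` ones
combined by addition and multiplication. -/
inductive CanWrite : ℕ → ℕ → Prop
  | one : CanWrite 1 1
  | add {a b j k : ℕ} : CanWrite a j → CanWrite b k → CanWrite (a + b) (j + k)
  | mul {a b j k : ℕ} : CanWrite a j → CanWrite b k → CanWrite (a * b) (j + k)

/-- The integer complexity `‖n‖`: the least number of ones needed to write `n`. -/
noncomputable def cpx (n : ℕ) : ℕ := sInf {k | CanWrite n k}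

/-- The defect `δ(n) = ‖n‖ - 3 log₃ n`. -/
noncomputable def defect (n : ℕ) : ℝ := (cpx n : ℝ) - 3 * Real.logb 3 n

/-- `n` is stable if `‖3^k n‖ = 3k + ‖n‖` for all `k ≥ 0`. -/
def Stable (n : ℕ) : Prop := ∀ k : ℕ, cpx (3 ^ k * n) = 3 * k + cpx n

/-- The stabilization length `K(n)`: the least `k` such that `3^k n` is stable. -/
noncomputable def stabLen (n : ℕ) : ℕ := sInf {k | Stable (3 ^ k * n)}

/-- The stable complexity `‖n‖_st`: equal to `‖3^k n‖ - 3k` for any `k` with `3^k n` stable. -/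
noncomputable def stableCpx (n : ℕ) : ℕ :=
  sInf {m | ∃ k : ℕ, Stable (3 ^ k * n) ∧ cpx (3 ^ k * n) = m + 3 * k}

/-- The stable defect `δ_st(n) = ‖n‖_st - 3 log₃ n`. -/
noncomputable def stableDefect (n : ℕ) : ℝ := (stableCpx n : ℝ) - 3 * Real.logb 3 n


/-- 3-adically good numbers -/
def GG : ℕ → ℕ → ℕ → Prop
  | 0, N, x => 0 < x ∧ x ≤ N
  | r + 1, N, x => (0 < x ∧ x ≤ N) ∨
      ∃ y k : ℕ, 0 < y ∧ y ≤ N ∧ x ≡ y [MOD 3 ^ k] ∧ GG r (N * 3 ^ k) x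

theorem GG.base {r N x : ℕ} (h0 : 0 < x) (h : x ≤ N) : GG r N x := by
  cases r with
  | zero => exact ⟨h0, h⟩
  | succ r => exact Or.inl ⟨h0, h⟩

theorem GG.mono {r r' N N' x : ℕ} (h : GG r N x) (hr : r ≤ r') (hN : N ≤ N') : GG r' N' x := by
  induction r generalizing r' N N' with
  | zero => exact GG.base h.1 (h.2.trans hN)
  | succ r ih =>
    obtain ⟨s, rfl⟩ : ∃ s, r' = s + 1 := ⟨r' - 1, by omega⟩
    rcases h with h | ⟨y, k, hy, hyN, hm, hg⟩
    · exact GG.base h.1 (h.2.trans hN)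
    · exact Or.inr ⟨y, k, hy, hyN.trans hN, hm, ih hg (by omega) (Nat.mul_le_mul_right _ hN)⟩

theorem GG.pos {r N x : ℕ} (h : GG r N x) : 0 < x := by
  induction r generalizing N with
  | zero => exact h.1
  | succ r ih =>
    rcases h with h | ⟨y, k, hy, hyN, hm, hg⟩
    · exact h.1
    · exact ih hg

theorem GG.affine {r N x : ℕ} (c b : ℕ) (hc : 0 < c) (h : GG r N x) :
    GG r (c * N + b) (c * x + b) := by
  induction r generalizing N with
  | zero => exact ⟨by have := Nat.mul_pos hc h.1; omega, by have := Nat.mul_le_mul_left c h.2; omega⟩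
  | succ r ih =>
    rcases h with h | ⟨y, k, hy, hyN, hm, hg⟩
    · exact GG.base (by have := Nat.mul_pos hc h.1; omega)
        (by have := Nat.mul_le_mul_left c h.2; omega)
    · refine Or.inr ⟨c * y + b, k, by have := Nat.mul_pos hc hy; omega,
        by have := Nat.mul_le_mul_left c hyN; omega, (hm.mul_left c).add_right b, ?_⟩
      refine (ih hg).mono le_rfl ?_
      have : 1 ≤ 3 ^ k := Nat.one_le_pow _ _ (by norm_num)
      nlinarith

theorem GG.step {r N x : ℕ} (k b : ℕ) (hb : 0 < b) (h : GG r N x) :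
    GG (r + 1) (N + b) (3 ^ k * x + b) := by
  refine Or.inr ⟨b, k, hb, by omega, ?_, ?_⟩
  · simp [Nat.ModEq]
  · refine (h.affine (3 ^ k) b (by positivity)).mono le_rfl ?_
    have : 1 ≤ 3 ^ k := Nat.one_le_pow _ _ (by norm_num)
    nlinarith

theorem GG.mul_aux (s : ℕ) : ∀ {r r' N N' x x' : ℕ}, r + r' = s → GG r N x → GG r' N' x' →
    GG s (N * N') (x * x') := by
  induction s with
  | zero =>
    intro r r' N N' x x' hs h h'
    obtain rfl : r = 0 := by omega
    obtain rfl : r' = 0 := by omega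
    exact ⟨Nat.mul_pos h.1 h'.1, Nat.mul_le_mul h.2 h'.2⟩
  | succ s ih =>
    have key : ∀ {r r' N N' x x' y y' k : ℕ}, r + r' = s → GG r (N * 3 ^ k) x → GG r' N' x' →
        0 < y → y ≤ N → 0 < y' → y' ≤ N' → x ≡ y [MOD 3 ^ k] → x' ≡ y' [MOD 3 ^ k] →
        GG (s + 1) (N * N') (x * x') := by
      intro r r' N N' x x' y y' k hs h h' hy hyN hy' hyN' hm hm'
      refine Or.inr ⟨y * y', k, Nat.mul_pos hy hy', Nat.mul_le_mul hyN hyN', hm.mul hm', ?_⟩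
      refine (ih hs h h').mono le_rfl (le_of_eq (by ring))
    have small : ∀ {r N x : ℕ}, GG r N x → (0 < x ∧ x ≤ N) ∨ ∃ q, r = q + 1 ∧
      ∃ y k : ℕ, 0 < y ∧ y ≤ N ∧ x ≡ y [MOD 3 ^ k] ∧ GG q (N * 3 ^ k) x := by
      intro r N x h
      cases r with
      | zero => exact Or.inl h
      | succ r =>
        rcases h with h | h
        · exact Or.inl h
        · exact Or.inr ⟨r, rfl, h⟩
    intro r r' N N' x x' hs h h'
    rcases small h with h1 | ⟨q, rfl, y, k, hy, hyN, hm, hg⟩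
    · rcases small h' with h2 | ⟨q', rfl, y', k', hy', hyN', hm', hg'⟩
      · exact GG.base (Nat.mul_pos h1.1 h2.1) (Nat.mul_le_mul h1.2 h2.2)
      · rw [mul_comm x, mul_comm N]
        exact key (by omega) hg' h hy' hyN' h1.1 h1.2 hm' rfl
    · rcases small h' with h2 | ⟨q', rfl, y', k', hy', hyN', hm', hg'⟩
      · exact key (by omega) hg h' hy hyN h2.1 h2.2 hm rfl
      · rcases le_total k k' with hk | hk
        · exact key (by omega) hg h' hy hyN hy' hyN' hm (hm'.of_dvd (pow_dvd_pow 3 hk))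
        · rw [mul_comm x, mul_comm N]
          exact key (by omega) hg' h hy' hyN' hy hyN hm' (hm.of_dvd (pow_dvd_pow 3 hk))

theorem GG.val {r N x v : ℕ} (h : GG r N x) (hv : 3 ^ v ∣ x) : 3 ^ v ≤ N ^ 2 ^ r := by
  induction r generalizing N with
  | zero => simpa using (Nat.le_of_dvd h.1 hv).trans h.2
  | succ r ih =>
    have hN : ∀ {z : ℕ}, 0 < z → z ≤ N → 3 ^ v ∣ z → 3 ^ v ≤ N ^ 2 ^ (r + 1) := by
      intro z hz hzN hd
      exact ((Nat.le_of_dvd hz hd).trans hzN).trans (Nat.le_self_pow (by positivity) N)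
    rcases h with h | ⟨y, k, hy, hyN, hm, hg⟩
    · exact hN h.1 h.2 hv
    · rcases le_or_gt (3 ^ k) N with hk | hk
      · calc 3 ^ v ≤ (N * 3 ^ k) ^ 2 ^ r := ih hg
          _ ≤ (N * N) ^ 2 ^ r := by gcongr
          _ = N ^ 2 ^ (r + 1) := by rw [← pow_two, ← pow_mul, pow_succ, mul_comm]
      · rcases le_total v k with hvk | hvk
        · exact hN hy hyN (((hm.of_dvd (pow_dvd_pow 3 hvk)).dvd_iff dvd_rfl).1 hv)
        · have := (hm.dvd_iff dvd_rfl).1 ((pow_dvd_pow 3 hvk).trans hv)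
          have := Nat.le_of_dvd hy this
          omega

theorem CanWrite.pos {n c : ℕ} (h : CanWrite n c) : 0 < n ∧ 0 < c := by
  induction h with
  | one => simp
  | add _ _ h1 h2 => omega
  | mul _ _ h1 h2 => exact ⟨Nat.mul_pos h1.1 h2.1, by omega⟩

theorem CanWrite.gap {n c : ℕ} (h : CanWrite n c) : n ^ 3 = 3 ^ c ∨ 9 * n ^ 3 ≤ 8 * 3 ^ c := by
  induction h with
  | one => right; norm_num
  | @mul a b j k ha hb h1 h2 =>
    have e1 : (a * b) ^ 3 = a ^ 3 * b ^ 3 := by ring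
    have e2 : 3 ^ (j + k) = 3 ^ j * 3 ^ k := pow_add _ _ _
    rw [e1, e2]
    rcases h1 with h1 | h1 <;> rcases h2 with h2 | h2
    · left; rw [h1, h2]
    · right; rw [h1]; nlinarith [Nat.zero_le (3 ^ j)]
    · right; rw [h2]; nlinarith [Nat.zero_le (3 ^ k)]
    · right; nlinarith [Nat.mul_le_mul h1 h2, Nat.zero_le (3 ^ j * 3 ^ k)]
  | @add a b j k ha hb h1 h2 =>
    have e2 : 3 ^ (j + k) = 3 ^ j * 3 ^ k := pow_add _ _ _
    have l1 : a ^ 3 ≤ 3 ^ j := by omega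
    have l2 : b ^ 3 ≤ 3 ^ k := by omega
    have p1 := ha.pos
    have p2 := hb.pos
    have key1 : ∀ {a j k : ℕ}, 0 < a → 0 < j → 0 < k → a ^ 3 ≤ 3 ^ j →
        (a + 1) ^ 3 = 3 ^ (j + k) ∨ 9 * (a + 1) ^ 3 ≤ 8 * 3 ^ (j + k) := by
      intro a j k ha hj hk l1
      have e2 : 3 ^ (j + k) = 3 ^ j * 3 ^ k := pow_add _ _ _
      have hk3 : 3 ^ 1 ≤ 3 ^ k := Nat.pow_le_pow_right (by norm_num) hk
      have hj3 : 3 ^ 1 ≤ 3 ^ j := Nat.pow_le_pow_right (by norm_num) hj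
      obtain rfl | rfl | ha3 : a = 1 ∨ a = 2 ∨ 3 ≤ a := by omega
      · right; rw [e2]; nlinarith
      · have : 2 ≤ j := by
          by_contra hh
          obtain rfl : j = 1 := by omega
          norm_num at l1
        obtain h | h : j + k = 3 ∨ 5 ≤ j + k + 1 := by omega
        · left; rw [h]
        · right
          have : 3 ^ 4 ≤ 3 ^ (j + k) := Nat.pow_le_pow_right (by norm_num) (by omega)
          norm_num at this ⊢
          omega
      · right
        rw [e2]
        have : 27 * (a + 1) ^ 3 ≤ 64 * a ^ 3 := by
          calc 27 * (a + 1) ^ 3 = (3 * (a + 1)) ^ 3 := by ring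
            _ ≤ (4 * a) ^ 3 := Nat.pow_le_pow_left (by omega) 3
            _ = _ := by ring
        have : 3 ^ j * 3 ≤ 3 ^ j * 3 ^ k := Nat.mul_le_mul_left _ (by simpa using hk3)
        omega
    rcases Nat.eq_or_lt_of_le (Nat.succ_le_of_lt p2.1) with hb1 | hb1
    · obtain rfl : b = 1 := by omega
      exact key1 p1.1 p1.2 p2.2 l1
    rcases Nat.eq_or_lt_of_le (Nat.succ_le_of_lt p1.1) with ha1 | ha1
    · obtain rfl : a = 1 := by omega
      rw [add_comm 1 b, add_comm j k]
      exact key1 p2.1 p2.2 p1.2 l2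
    right
    have hab : a + b ≤ a * b := by nlinarith
    have hm : (a * b) ^ 3 ≤ 3 ^ j * 3 ^ k := by
      rw [mul_pow]; exact Nat.mul_le_mul l1 l2
    have h83 : 9 * (a * b) ^ 3 ≤ 8 * 3 ^ (j + k) → 9 * (a + b) ^ 3 ≤ 8 * 3 ^ (j + k) := by
      intro h
      have := Nat.pow_le_pow_left hab 3
      omega
    rcases h1 with h1 | h1
    · rcases h2 with h2 | h2
      · have ha2 : a ≠ 2 := by
          rintro rfl
          have := congrArg (· % 3) h1
          have h3 : 3 ∣ 3 ^ j := dvd_pow_self 3 (by omega)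
          omega
        have hb2 : b ≠ 2 := by
          rintro rfl
          have h3 : 3 ∣ 3 ^ k := dvd_pow_self 3 (by omega)
          omega
        have h32 : 3 * (a + b) ≤ 2 * (a * b) := by
          have : 3 ≤ a := by omega
          have : 3 ≤ b := by omega
          nlinarith
        have := Nat.pow_le_pow_left h32 3
        rw [mul_pow, mul_pow 2] at this
        rw [e2]
        omega
      · apply h83
        rw [mul_pow, e2, h1]; nlinarith [Nat.zero_le (3 ^ j)]
    · apply h83
      rw [mul_pow, e2]
      nlinarith [Nat.mul_le_mul h1 l2]

theorem CanWrite.le {n c : ℕ} (h : CanWrite n c) : n ^ 3 ≤ 3 ^ c := by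
  have := h.gap
  omega

def NN : ℕ → ℕ
  | 0 => 3
  | D + 1 => NN D * NN D + 8 * 2 ^ (D + 1)

theorem NN_ge (D : ℕ) : 3 ≤ NN D := by
  induction D with
  | zero => simp [NN]
  | succ D ih => simp only [NN]; nlinarith [Nat.zero_le (2 ^ (D + 1))]

/-- 3-power structure of low-defect numbers -/
theorem CanWrite.struct {n c : ℕ} (h : CanWrite n c) : ∀ D : ℕ, 8 ^ D * 3 ^ c ≤ 9 ^ D * n ^ 3 →
    ∃ j y c', n = 3 ^ j * y ∧ c = c' + 3 * j ∧ CanWrite y c' ∧ GG (2 ^ D - 1) (NN D) y := by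
  have hcw := h
  induction h with
  | one =>
    intro D _
    exact ⟨0, 1, 1, by simp, by simp, CanWrite.one,
      GG.base one_pos (by have := NN_ge D; omega)⟩
  | @mul a b j k ha hb h1 h2 =>
    have hpow : ∀ {a j : ℕ}, a ^ 3 = 3 ^ j → ∃ i, a = 3 ^ i ∧ j = 3 * i := by
      intro a j h
      have : a ∣ 3 ^ j := h ▸ dvd_pow_self a (by norm_num)
      obtain ⟨i, -, rfl⟩ := (Nat.dvd_prime_pow Nat.prime_three).1 this
      refine ⟨i, rfl, ?_⟩
      rw [← pow_mul] at h
      have := Nat.pow_right_injective (le_refl _ |>.trans (by norm_num : 2 ≤ 3)) h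
      omega
    intro D hD
    rcases ha.gap with ga | ga
    · obtain ⟨i, rfl, rfl⟩ := hpow ga
      have : 8 ^ D * 3 ^ k ≤ 9 ^ D * b ^ 3 := by
        have h0 : 0 < 3 ^ (3 * i) := by positivity
        refine Nat.le_of_mul_le_mul_left ?_ h0
        calc 3 ^ (3 * i) * (8 ^ D * 3 ^ k) = 8 ^ D * 3 ^ (3 * i + k) := by rw [pow_add]; ring
          _ ≤ _ := hD
          _ = _ := by rw [mul_pow, ga]; ring
      obtain ⟨j, y, c', rfl, rfl, hc, hG⟩ := h2 hb D this
      exact ⟨i + j, y, c', by ring, by ring, hc, hG⟩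
    rcases hb.gap with gb | gb
    · obtain ⟨i, rfl, rfl⟩ := hpow gb
      have : 8 ^ D * 3 ^ j ≤ 9 ^ D * a ^ 3 := by
        have h0 : 0 < 3 ^ (3 * i) := by positivity
        refine Nat.le_of_mul_le_mul_left ?_ h0
        calc 3 ^ (3 * i) * (8 ^ D * 3 ^ j) = 8 ^ D * 3 ^ (j + 3 * i) := by rw [pow_add]; ring
          _ ≤ _ := hD
          _ = _ := by rw [mul_pow, gb]; ring
      obtain ⟨j, y, c', rfl, rfl, hc, hG⟩ := h1 ha D this
      exact ⟨i + j, y, c', by ring, by ring, hc, hG⟩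
    have side : ∀ {a b j k D : ℕ}, 0 < a → 0 < b → 8 ^ D * 3 ^ (j + k) ≤ 9 ^ D * (a * b) ^ 3 →
        9 * a ^ 3 ≤ 8 * 3 ^ j → b ^ 3 ≤ 3 ^ k → ∃ E, D = E + 1 ∧ 8 ^ E * 3 ^ k ≤ 9 ^ E * b ^ 3 := by
      intro a b j k D ha hb hD ga hbk
      have hj : 0 < 3 ^ j := by positivity
      have hk : 0 < 3 ^ k := by positivity
      cases D with
      | zero =>
        exfalso
        rw [pow_add, mul_pow] at hD
        simp only [pow_zero, one_mul] at hD
        nlinarith [Nat.mul_le_mul ga hbk, Nat.mul_pos hj hk]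
      | succ E =>
        refine ⟨E, rfl, ?_⟩
        have h0 : 0 < 8 * 3 ^ j := by positivity
        refine Nat.le_of_mul_le_mul_left ?_ h0
        calc 8 * 3 ^ j * (8 ^ E * 3 ^ k) = 8 ^ (E + 1) * 3 ^ (j + k) := by rw [pow_add 3]; ring
          _ ≤ _ := hD
          _ = (9 * a ^ 3) * (9 ^ E * b ^ 3) := by rw [mul_pow]; ring
          _ ≤ _ := Nat.mul_le_mul_right _ ga
    obtain ⟨E, rfl, hE⟩ := side ha.pos.1 hb.pos.1 hD ga hb.le
    obtain ⟨E', hEE, hE'⟩ := side hb.pos.1 ha.pos.1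
      (by rw [add_comm k, mul_comm b]; exact hD) gb ha.le
    obtain rfl : E = E' := by omega
    obtain ⟨j1, y1, c1, rfl, rfl, hc1, hG1⟩ := h1 ha E hE'
    obtain ⟨j2, y2, c2, rfl, rfl, hc2, hG2⟩ := h2 hb E hE
    refine ⟨j1 + j2, y1 * y2, c1 + c2, by ring, by ring, hc1.mul hc2, ?_⟩
    refine (GG.mul_aux _ rfl hG1 hG2).mono ?_ ?_
    · rw [pow_succ]; omega
    · simp only [NN]; omega
  | @add a b j k ha hb h1 h2 =>
    have main : ∀ {a b j k : ℕ}, CanWrite a j → CanWrite b k → b ≤ a →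
        (∀ D : ℕ, 8 ^ D * 3 ^ j ≤ 9 ^ D * a ^ 3 →
        ∃ j' y c', a = 3 ^ j' * y ∧ j = c' + 3 * j' ∧ CanWrite y c' ∧ GG (2 ^ D - 1) (NN D) y) →
        ∀ D : ℕ, 8 ^ D * 3 ^ (j + k) ≤ 9 ^ D * (a + b) ^ 3 → GG (2 ^ D - 1) (NN D) (a + b) := by
      intro a b j k ha hb hba ih D hD
      have pa := ha.pos
      have pb := hb.pos
      have la := ha.le
      have lb := hb.le
      have hj : 0 < 3 ^ j := by positivity
      have hk : 0 < 3 ^ k := by positivity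
      by_cases hs : a + b ≤ 3
      · exact GG.base (by omega) (hs.trans (NN_ge D))
      have hred : 9 * (a + b) ^ 3 ≤ 8 * 3 ^ k * a ^ 3 := by
        rcases Nat.lt_or_ge k 2 with hk2 | hk2
        · obtain rfl : k = 1 := by omega
          have hb1 : b = 1 := by
            by_contra hne
            have : 2 ^ 3 ≤ b ^ 3 := Nat.pow_le_pow_left (by omega) 3
            omega
          subst hb1
          have : 27 * (a + 1) ^ 3 ≤ 64 * a ^ 3 := by
            calc 27 * (a + 1) ^ 3 = (3 * (a + 1)) ^ 3 := by ring
              _ ≤ (4 * a) ^ 3 := Nat.pow_le_pow_left (by omega) 3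
              _ = _ := by ring
          omega
        · have h9 : 3 ^ 2 ≤ 3 ^ k := Nat.pow_le_pow_right (by norm_num) hk2
          calc 9 * (a + b) ^ 3 ≤ 9 * (2 * a) ^ 3 := by gcongr; omega
            _ = 8 * 3 ^ 2 * a ^ 3 := by ring
            _ ≤ _ := by gcongr
      cases D with
      | zero =>
        exfalso
        rw [pow_add] at hD
        simp only [pow_zero, one_mul] at hD
        nlinarith [Nat.mul_le_mul_left (3 ^ k) la, Nat.mul_pos hj hk]
      | succ E =>
        have hE : 8 ^ E * 3 ^ j ≤ 9 ^ E * a ^ 3 := by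
          have h0 : 0 < 8 * 3 ^ k := by positivity
          refine Nat.le_of_mul_le_mul_left ?_ h0
          calc 8 * 3 ^ k * (8 ^ E * 3 ^ j) = 8 ^ (E + 1) * 3 ^ (j + k) := by rw [pow_add 3]; ring
            _ ≤ _ := hD
            _ = 9 ^ E * (9 * (a + b) ^ 3) := by ring
            _ ≤ 9 ^ E * (8 * 3 ^ k * a ^ 3) := Nat.mul_le_mul_left _ hred
            _ = _ := by ring
        have hbb : b ≤ 8 * 2 ^ (E + 1) := by
          have h1 : 8 ^ (E + 1) * 3 ^ k ≤ 9 ^ (E + 1) * 8 := by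
            refine Nat.le_of_mul_le_mul_left ?_ hj
            calc 3 ^ j * (8 ^ (E + 1) * 3 ^ k) = 8 ^ (E + 1) * 3 ^ (j + k) := by
                  rw [pow_add 3]; ring
              _ ≤ _ := hD
              _ ≤ 9 ^ (E + 1) * (2 * a) ^ 3 := by gcongr; omega
              _ = 9 ^ (E + 1) * 8 * a ^ 3 := by ring
              _ ≤ 9 ^ (E + 1) * 8 * 3 ^ j := by gcongr
              _ = _ := by ring
          have h2 : 9 ^ (E + 1) ≤ 8 ^ (E + 1) * 2 ^ (E + 1) := by
            rw [← mul_pow]; gcongr; norm_num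
          have h3 : 3 ^ k ≤ 8 * 2 ^ (E + 1) := by
            have h0 : 0 < 8 ^ (E + 1) := by positivity
            refine Nat.le_of_mul_le_mul_left (h1.trans ?_) h0
            nlinarith
          exact (Nat.le_self_pow (by norm_num) b).trans (lb.trans h3)
        obtain ⟨j', y, c', rfl, -, hy, hG⟩ := ih E hE
        refine (hG.step j' b pb.1).mono ?_ ?_
        · have : 1 ≤ 2 ^ E := Nat.one_le_two_pow
          rw [pow_succ]; omega
        · simp only [NN]
          have := NN_ge E
          nlinarith
    intro D hD
    refine ⟨0, a + b, j + k, by simp, by simp, hcw, ?_⟩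
    rcases le_total b a with hba | hba
    · exact main ha hb hba (h1 ha) D hD
    · rw [add_comm a b]
      exact main hb ha hba (h2 hb) D (by rw [add_comm b a, add_comm k j]; exact hD)

theorem canWrite_self {n : ℕ} (h : 0 < n) : CanWrite n n := by
  induction n, h using Nat.le_induction with
  | base => exact CanWrite.one
  | succ n _ ih => exact ih.add CanWrite.one

theorem cpx_spec {n : ℕ} (h : 0 < n) : CanWrite n (cpx n) :=
  Nat.sInf_mem (s := {k | CanWrite n k}) ⟨n, canWrite_self h⟩

theorem cpx_le {n k : ℕ} (h : CanWrite n k) : cpx n ≤ k := Nat.sInf_le h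

theorem canWrite_pow {n c : ℕ} (h : CanWrite n c) (k : ℕ) : CanWrite (3 ^ k * n) (3 * k + c) := by
  induction k with
  | zero => simpa using h
  | succ k ih =>
    have := (canWrite_self (n := 3) (by norm_num)).mul ih
    convert this using 1 <;> ring

theorem cpx_pow_le {n : ℕ} (h : 0 < n) (k : ℕ) : cpx (3 ^ k * n) ≤ 3 * k + cpx n :=
  cpx_le (canWrite_pow (cpx_spec h) k)

/-- a bound for the stabilization length -/
def MM (n : ℕ) : ℕ := NN (10 * n) ^ 2 ^ (2 ^ (10 * n) - 1)

theorem cpx_MM {n : ℕ} (h : 0 < n) (i : ℕ) :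
    cpx (3 ^ (MM n + i) * n) = 3 * i + cpx (3 ^ MM n * n) := by
  apply le_antisymm
  · have := cpx_pow_le (n := 3 ^ MM n * n) (by positivity) i
    rwa [← mul_assoc, ← pow_add, add_comm i] at this
  · set k := MM n + i with hk
    have hspec := cpx_spec (n := 3 ^ k * n) (by positivity)
    obtain ⟨j, y, c', hy, hc, hyc, hG⟩ := hspec.struct (10 * n) (by
      have h1 : cpx (3 ^ k * n) ≤ 3 * k + n := cpx_le (canWrite_pow (canWrite_self h) k)
      calc 8 ^ (10 * n) * 3 ^ cpx (3 ^ k * n) ≤ 8 ^ (10 * n) * 3 ^ (3 * k + n) := by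
            gcongr; norm_num
        _ = (8 ^ 10 * 3) ^ n * 3 ^ (3 * k) := by
            rw [pow_add, pow_mul 8, mul_pow]; ring
        _ ≤ (9 ^ 10) ^ n * 3 ^ (3 * k) := by gcongr; norm_num
        _ = 9 ^ (10 * n) * (3 ^ k) ^ 3 * 1 := by rw [← pow_mul, ← pow_mul 3, mul_comm k]; ring
        _ ≤ 9 ^ (10 * n) * (3 ^ k) ^ 3 * n ^ 3 := by
            gcongr; exact Nat.one_le_pow _ _ h
        _ = _ := by ring)
    have hj : k ≤ j + MM n := by
      by_contra hlt
      have hd : 3 ^ (k - j) ∣ y := by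
        have : 3 ^ k = 3 ^ j * 3 ^ (k - j) := by rw [← pow_add]; congr 1; omega
        rw [this, mul_assoc] at hy
        exact ⟨n, (Nat.eq_of_mul_eq_mul_left (by positivity) hy).symm⟩
      have := hG.val hd
      have h2 : k - j < 3 ^ (k - j) := Nat.lt_pow_self (by norm_num)
      have : 3 ^ (k - j) ≤ MM n := this
      omega
    have hij : i ≤ j := by omega
    have he : 3 ^ MM n * n = 3 ^ (j - i) * y := by
      have h0 : 0 < 3 ^ i := by positivity
      refine Nat.eq_of_mul_eq_mul_left h0 ?_
      rw [← mul_assoc, ← mul_assoc, ← pow_add, ← pow_add, Nat.add_sub_cancel' hij, ← hy, hk,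
        add_comm i]
    have h5 := cpx_le (canWrite_pow hyc (j - i))
    rw [← he] at h5
    omega

theorem stable_iff {n : ℕ} (h : 0 < n) (k : ℕ) :
    Stable (3 ^ k * n) ↔ cpx (3 ^ k * n) + 3 * MM n = cpx (3 ^ MM n * n) + 3 * k := by
  have hp : 0 < 3 ^ k * n := by positivity
  have hadd : ∀ i, 3 ^ i * (3 ^ k * n) = 3 ^ (k + i) * n := by
    intro i; rw [← mul_assoc, ← pow_add, add_comm]
  constructor
  · intro hs
    have h1 := hs (MM n)
    rw [hadd, add_comm k, cpx_MM h] at h1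
    omega
  · intro he i
    have h1 := cpx_pow_le hp i
    have h2 := cpx_pow_le (n := 3 ^ i * (3 ^ k * n)) (by positivity) (MM n)
    rw [hadd, ← mul_assoc, ← pow_add, cpx_MM h (k + i)] at h2
    rw [hadd] at h1 ⊢
    omega

theorem stabLen_eq {n : ℕ} (h : 0 < n) :
    stabLen n = sInf {k | cpx (3 ^ k * n) + 3 * MM n = cpx (3 ^ MM n * n) + 3 * k} := by
  unfold stabLen
  congr 1
  ext k
  exact stable_iff h k

theorem stableCpx_eq {n : ℕ} (h : 0 < n) : stableCpx n = cpx (3 ^ MM n * n) - 3 * MM n := by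
  have hge : 3 * MM n ≤ cpx (3 ^ MM n * n) := by
    have h1 := (cpx_spec (n := 3 ^ MM n * n) (by positivity)).le
    have h2 : 3 ^ (3 * MM n) ≤ (3 ^ MM n * n) ^ 3 := by
      rw [mul_pow, ← pow_mul, mul_comm 3]
      exact Nat.le_mul_of_pos_right _ (by positivity)
    exact (Nat.pow_le_pow_iff_right (by norm_num : 1 < 3)).1 (h2.trans h1)
  unfold stableCpx
  have : {m | ∃ k : ℕ, Stable (3 ^ k * n) ∧ cpx (3 ^ k * n) = m + 3 * k} =
      {cpx (3 ^ MM n * n) - 3 * MM n} := by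
    ext m
    simp only [Set.mem_ofPred_eq, Set.mem_singleton_iff]
    constructor
    · rintro ⟨k, hs, hm⟩
      rw [stable_iff h] at hs
      omega
    · intro hm
      exact ⟨MM n, (stable_iff h _).2 rfl, by omega⟩
  rw [this, csInf_singleton]

/-- `sInf` of a computable family of nonempty sets is computable. -/
theorem computable_sInf {f g : ℕ → ℕ → ℕ} (hf : Computable₂ f) (hg : Computable₂ g)
    (h : ∀ n, ∃ k, f n k = g n k) : Computable (fun n => sInf {k | f n k = g n k}) := by
  have hd : Computable₂ (fun n k => decide (f n k = g n k)) :=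
    (Primrec.eq (α := ℕ)).decide.to_comp.comp hf hg
  refine (Partrec.rfind (hd.partrec₂)).of_eq_tot ?_
  intro n
  have h1 : f n (sInf {k | f n k = g n k}) = g n (sInf {k | f n k = g n k}) :=
    Nat.sInf_mem (s := {k | f n k = g n k}) (h n)
  rw [Nat.mem_rfind]
  refine ⟨by simpa using h1, ?_⟩
  intro m hm
  have := Nat.notMem_of_lt_sInf hm
  simpa using this

/-- All pairs `(n, k)` obtained by derivations of depth at most `t`. -/
def derivs (t : ℕ) : List (ℕ × ℕ) :=
  Nat.rec [(1, 1)] (fun _ L => L ++ L.flatMap (fun p => L.map (fun q => (p.1 + q.1, p.2 + q.2)) ++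
    L.map (fun q => (p.1 * q.1, p.2 + q.2)))) t

theorem derivs_succ (t : ℕ) : derivs (t + 1) = derivs t ++ (derivs t).flatMap (fun p =>
    (derivs t).map (fun q => (p.1 + q.1, p.2 + q.2)) ++
    (derivs t).map (fun q => (p.1 * q.1, p.2 + q.2))) := rfl

theorem derivs_mono {t t' : ℕ} (h : t ≤ t') {p : ℕ × ℕ} (hp : p ∈ derivs t) : p ∈ derivs t' := by
  induction t', h using Nat.le_induction with
  | base => exact hp
  | succ m _ ih => rw [derivs_succ]; exact List.mem_append_left _ ih

theorem derivs_sound (t : ℕ) : ∀ p ∈ derivs t, CanWrite p.1 p.2 := by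
  induction t with
  | zero =>
    intro p hp
    obtain rfl : p = (1, 1) := by simpa [derivs] using hp
    exact CanWrite.one
  | succ t ih =>
    intro p hp
    rw [derivs_succ, List.mem_append, List.mem_flatMap] at hp
    rcases hp with hp | ⟨q, hq, hp⟩
    · exact ih p hp
    · rw [List.mem_append, List.mem_map, List.mem_map] at hp
      rcases hp with ⟨s, hs, rfl⟩ | ⟨s, hs, rfl⟩
      · exact (ih q hq).add (ih s hs)
      · exact (ih q hq).mul (ih s hs)

theorem derivs_complete {n k : ℕ} (h : CanWrite n k) : (n, k) ∈ derivs k := by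
  induction h with
  | one => exact derivs_mono (Nat.zero_le 1) (by simp [derivs])
  | @add a b j k ha hb h1 h2 =>
    have p1 := ha.pos
    have p2 := hb.pos
    obtain ⟨t, ht⟩ : ∃ t, j + k = t + 1 := ⟨j + k - 1, by omega⟩
    have h1' := derivs_mono (t' := t) (by omega) h1
    have h2' := derivs_mono (t' := t) (by omega) h2
    have : (a + b, j + k) ∈ derivs (t + 1) := by
      rw [derivs_succ, List.mem_append, List.mem_flatMap]
      refine Or.inr ⟨_, h1', ?_⟩
      rw [List.mem_append, List.mem_map]
      exact Or.inl ⟨_, h2', rfl⟩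
    rwa [← ht] at this
  | @mul a b j k ha hb h1 h2 =>
    have p1 := ha.pos
    have p2 := hb.pos
    obtain ⟨t, ht⟩ : ∃ t, j + k = t + 1 := ⟨j + k - 1, by omega⟩
    have h1' := derivs_mono (t' := t) (by omega) h1
    have h2' := derivs_mono (t' := t) (by omega) h2
    have : (a * b, j + k) ∈ derivs (t + 1) := by
      rw [derivs_succ, List.mem_append, List.mem_flatMap]
      refine Or.inr ⟨_, h1', ?_⟩
      rw [List.mem_append, List.mem_map, List.mem_map]
      exact Or.inr ⟨_, h2', rfl⟩
    rwa [← ht] at this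

theorem primrec_derivs : Primrec derivs := by
  unfold derivs
  refine Primrec.nat_rec₁ _ (Primrec.list_append.comp Primrec.snd ?_)
  refine Primrec.list_flatMap Primrec.snd ?_
  have hL : Primrec (fun x : (ℕ × List (ℕ × ℕ)) × (ℕ × ℕ) => x.1.2) :=
    Primrec.snd.comp Primrec.fst
  have hp : Primrec (fun x : ((ℕ × List (ℕ × ℕ)) × (ℕ × ℕ)) × (ℕ × ℕ) => x.1.2) :=
    Primrec.snd.comp Primrec.fst
  have hq : Primrec (fun x : ((ℕ × List (ℕ × ℕ)) × (ℕ × ℕ)) × (ℕ × ℕ) => x.2) := Primrec.snd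
  have hs := Primrec.nat_add.comp (Primrec.snd.comp hp) (Primrec.snd.comp hq)
  refine Primrec.list_append.comp (Primrec.list_map hL ?_) (Primrec.list_map hL ?_)
  · exact Primrec.pair (Primrec.nat_add.comp (Primrec.fst.comp hp) (Primrec.fst.comp hq)) hs
  · exact Primrec.pair (Primrec.nat_mul.comp (Primrec.fst.comp hp) (Primrec.fst.comp hq)) hs

theorem primrec_canWrite : PrimrecRel CanWrite := by
  have h1 : PrimrecRel (fun (L : List (ℕ × ℕ)) (b : ℕ × ℕ) => ∃ a ∈ L, a = b) :=
    Primrec.eq.exists_mem_list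
  have h2 : PrimrecPred (fun x : ℕ × ℕ => ∃ a ∈ derivs x.2, a = x) :=
    h1.comp (primrec_derivs.comp Primrec.snd) Primrec.id
  refine h2.of_eq ?_
  rintro ⟨n, k⟩
  constructor
  · rintro ⟨a, ha, rfl⟩
    exact derivs_sound _ _ ha
  · intro h
    exact ⟨_, derivs_complete h, rfl⟩

theorem computable_cpx : Computable cpx := by
  classical
  have hd : Primrec₂ (fun n k => if CanWrite n k ∨ n = 0 then 0 else 1) :=
    Primrec.ite (PrimrecPred.or primrec_canWrite (Primrec.eq.comp Primrec.fst (Primrec.const 0)))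
      (Primrec.const 0) (Primrec.const 1)
  have h0 : Computable₂ (fun _ _ : ℕ => 0) := Computable.const 0
  refine (computable_sInf hd.to_comp h0 ?_).of_eq ?_
  · intro n
    rcases Nat.eq_zero_or_pos n with rfl | hn
    · exact ⟨0, by simp⟩
    · exact ⟨n, by simp [canWrite_self hn]⟩
  · intro n
    unfold cpx
    rcases Nat.eq_zero_or_pos n with rfl | hn
    · have : {k | CanWrite 0 k} = ∅ := by
        ext k
        simp only [Set.mem_ofPred_eq, Set.mem_empty_iff_false, iff_false]
        intro h
        exact absurd h.pos.1 (lt_irrefl 0)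
      rw [this]
      simp
    · congr 1
      ext k
      have : n ≠ 0 := by omega
      simp [this]

theorem primrec_pow : Primrec₂ (fun a b : ℕ => a ^ b) := by
  have : Primrec₂ (fun a b : ℕ => (Nat.rec 1 (fun _ r => r * a) b : ℕ)) :=
    Primrec.nat_rec (Primrec.const 1)
      (Primrec.nat_mul.comp (Primrec.snd.comp Primrec.snd) Primrec.fst).to₂
  refine this.of_eq ?_
  intro a b
  induction b with
  | zero => rfl
  | succ b ih => rw [pow_succ, ← ih]

theorem primrec_NN : Primrec NN := by
  have : Primrec (fun D : ℕ => (Nat.rec 3 (fun D r => r * r + 8 * 2 ^ (D + 1)) D : ℕ)) :=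
    Primrec.nat_rec₁ 3 (Primrec.nat_add.comp (Primrec.nat_mul.comp Primrec.snd Primrec.snd)
      (Primrec.nat_mul.comp (Primrec.const 8)
        (primrec_pow.comp (Primrec.const 2) (Primrec.succ.comp Primrec.fst))))
  refine this.of_eq ?_
  intro D
  induction D with
  | zero => rfl
  | succ D ih => simp only [NN, ← ih]

theorem primrec_MM : Primrec MM := by
  unfold MM
  have h10 : Primrec (fun n : ℕ => 10 * n) := Primrec.nat_mul.comp (Primrec.const 10) Primrec.id
  exact primrec_pow.comp (primrec_NN.comp h10) (primrec_pow.comp (Primrec.const 2)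
    (Primrec.nat_sub.comp (primrec_pow.comp (Primrec.const 2) h10) (Primrec.const 1)))

theorem stable_computable :
    (∃ f : ℕ → Bool, Computable f ∧ ∀ n : ℕ, 0 < n → (f n = true ↔ Stable n)) ∧
    (∃ g : ℕ → ℕ, Computable g ∧ ∀ n : ℕ, 0 < n → g n = stabLen n) ∧
    (∃ h : ℕ → ℕ, Computable h ∧ ∀ n : ℕ, 0 < n → h n = stableCpx n) := by
  have hM : Computable (fun n => cpx (3 ^ MM n * n)) :=
    computable_cpx.comp (Primrec.nat_mul.comp
      (primrec_pow.comp (Primrec.const 3) primrec_MM) Primrec.id).to_comp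
  have h3M : Computable (fun n => 3 * MM n) :=
    (Primrec.nat_mul.comp (Primrec.const 3) primrec_MM).to_comp
  have hadd : Computable₂ (fun a b : ℕ => a + b) := Primrec.nat_add.to_comp
  have hsub : Computable₂ (fun a b : ℕ => a - b) := Primrec.nat_sub.to_comp
  refine ⟨⟨fun n => decide (cpx n + 3 * MM n = cpx (3 ^ MM n * n)), ?_, ?_⟩, ⟨fun n =>
    sInf {k | cpx (3 ^ k * n) + 3 * MM n = cpx (3 ^ MM n * n) + 3 * k}, ?_, ?_⟩,
    ⟨fun n => cpx (3 ^ MM n * n) - 3 * MM n, ?_, ?_⟩⟩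
  · exact (Primrec.eq (α := ℕ)).decide.to_comp.comp (hadd.comp computable_cpx h3M) hM
  · intro n hn
    have := stable_iff hn 0
    simp only [pow_zero, one_mul, mul_zero, add_zero] at this
    rw [this, decide_eq_true_iff]
  · refine computable_sInf (f := fun n k => cpx (3 ^ k * n) + 3 * MM n)
      (g := fun n k => cpx (3 ^ MM n * n) + 3 * k) ?_ ?_ (fun n => ⟨MM n, rfl⟩)
    · exact hadd.comp (computable_cpx.comp (Primrec.nat_mul.comp
        (primrec_pow.comp (Primrec.const 3) Primrec.snd) Primrec.fst).to_comp)
        (h3M.comp Computable.fst)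
    · exact hadd.comp (hM.comp Computable.fst)
        (Primrec.nat_mul.comp (Primrec.const 3) Primrec.snd).to_comp
  · intro n hn
    exact (stabLen_eq hn).symm
  · exact hsub.comp hM h3M
  · intro n hn
    exact (stableCpx_eq hn).symm
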